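/- Suppose condition (⋆) holds and g is a simple graph on {1,…,n} with η_i(g) = k_i for every firm i. Then for every edge ij of g, Y_i(g − ij) ≤ Y_i(g); that is, no firm can increase its profit by deleting one of its collaboration links. -/

import Mathlib

open Finset

noncomputable def degree' {n : ℕ} (g : SimpleGraph (Fin n)) (i : Fin n) : ℕ :=
  Nat.card {j | g.Adj i j}

/-- The graph `g` with the edge `ij` deleted. -/
def delE {n : ℕ} (g : SimpleGraph (Fin n)) (i j : Fin n) : SimpleGraph (Fin n) :=
  g.deleteEdges {s(i, j)}

/-- The graph `g` with the edge `ij` added. -/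
def addE {n : ℕ} (g : SimpleGraph (Fin n)) (i j : Fin n) : SimpleGraph (Fin n) :=
  g ⊔ SimpleGraph.fromEdgeSet {s(i, j)}

/-- Cournot equilibrium quantity of firm `i` under collaboration graph `g`. -/
noncomputable def qty {n : ℕ} (α γ₀ : ℝ) (f : ℝ → ℝ) (k : Fin n → ℕ)
    (g : SimpleGraph (Fin n)) (i : Fin n) : ℝ :=
  (α - γ₀ - n * f ((degree' g i : ℝ) - (k i : ℝ))
    + ∑ j ∈ univ.erase i, f ((degree' g j : ℝ) - (k j : ℝ))) / (n + 1)

/-- Market price under collaboration graph `g`. -/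
noncomputable def price {n : ℕ} (α γ₀ : ℝ) (f : ℝ → ℝ) (k : Fin n → ℕ)
    (g : SimpleGraph (Fin n)) : ℝ :=
  α - ∑ i, qty α γ₀ f k g i

/-- Marginal cost of firm `i` under collaboration graph `g`. -/
noncomputable def cost {n : ℕ} (γ₀ : ℝ) (f : ℝ → ℝ) (k : Fin n → ℕ)
    (g : SimpleGraph (Fin n)) (i : Fin n) : ℝ :=
  γ₀ + f ((degree' g i : ℝ) - (k i : ℝ))

/-- Profit of firm `i` under collaboration graph `g`. -/
noncomputable def profit {n : ℕ} (α γ₀ : ℝ) (f : ℝ → ℝ) (k : Fin n → ℕ)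
    (g : SimpleGraph (Fin n)) (i : Fin n) : ℝ :=
  qty α γ₀ f k g i * (price α γ₀ f k g - cost γ₀ f k g i)

/-- In Cournot equilibrium the markup of a firm equals its quantity. -/
theorem price_sub_cost_eq_qty {n : ℕ} (α γ₀ : ℝ) (f : ℝ → ℝ) (k : Fin n → ℕ)
    (g : SimpleGraph (Fin n)) (i : Fin n) :
    price α γ₀ f k g - cost γ₀ f k g i = qty α γ₀ f k g i := by
  have hn : (n : ℝ) + 1 ≠ 0 := by positivity
  simp only [price, cost, qty, ← Finset.sum_div, Finset.sum_add_distrib, Finset.sum_sub_distrib,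
    Finset.sum_erase_eq_sub (Finset.mem_univ _), ← Finset.mul_sum, Finset.sum_const,
    Finset.card_univ, Fintype.card_fin, nsmul_eq_mul]
  field_simp
  ring

theorem degree'_delE_left {n : ℕ} {g : SimpleGraph (Fin n)} {i j : Fin n} (hij : g.Adj i j) :
    degree' (delE g i j) i + 1 = degree' g i := by
  have hset : {l | (delE g i j).Adj i l} = {l | g.Adj i l} \ {j} := by
    ext l
    simp only [delE, SimpleGraph.deleteEdges_adj, Set.mem_ofPred_eq, Set.mem_sdiff,
      Set.mem_singleton_iff, Sym2.congr_right]
  unfold degree'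
  rw [hset]
  exact Set.ncard_sdiff_singleton_add_one (s := {l | g.Adj i l}) hij (Set.toFinite _)

theorem delE_comm {n : ℕ} (g : SimpleGraph (Fin n)) (i j : Fin n) :
    delE g i j = delE g j i := by
  rw [delE, delE, Sym2.eq_swap]

theorem degree'_delE_right {n : ℕ} {g : SimpleGraph (Fin n)} {i j : Fin n} (hij : g.Adj i j) :
    degree' (delE g i j) j + 1 = degree' g j := by
  rw [delE_comm, degree'_delE_left hij.symm]

theorem degree'_delE_of_ne {n : ℕ} (g : SimpleGraph (Fin n)) {i j l : Fin n}
    (hi : l ≠ i) (hj : l ≠ j) : degree' (delE g i j) l = degree' g l := by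
  have hset : {m | (delE g i j).Adj l m} = {m | g.Adj l m} := by
    ext m
    simp [delE, hi, hj]
  rw [degree', hset, degree']

/-- Equilibrium quantity when every firm has its cost-minimising degree. -/
theorem qty_of_degree'_eq {n : ℕ} (α γ₀ : ℝ) (f : ℝ → ℝ) {k : Fin n → ℕ}
    {g : SimpleGraph (Fin n)} (hdeg : ∀ i, degree' g i = k i) (i : Fin n) :
    qty α γ₀ f k g i = (α - γ₀ - f 0) / (n + 1) := by
  simp only [qty, hdeg, sub_self, Finset.sum_erase_eq_sub (Finset.mem_univ _), Finset.sum_const,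
    Finset.card_univ, Fintype.card_fin, nsmul_eq_mul]
  ring

/-- Equilibrium quantity after firm `i` deletes a link from a graph in which every firm has its
cost-minimising degree. -/
theorem qty_delE_of_degree'_eq {n : ℕ} (α γ₀ : ℝ) (f : ℝ → ℝ) {k : Fin n → ℕ}
    {g : SimpleGraph (Fin n)} (hdeg : ∀ i, degree' g i = k i) {i j : Fin n} (hij : g.Adj i j) :
    qty α γ₀ f k (delE g i j) i =
      (α - γ₀ - f 0 - (n - 1) * (f (-1) - f 0)) / (n + 1) := by
  have hi : (degree' (delE g i j) i : ℝ) - k i = -1 := by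
    rw [← hdeg, ← degree'_delE_left hij]
    push_cast
    ring
  have hj : (degree' (delE g i j) j : ℝ) - k j = -1 := by
    rw [← hdeg, ← degree'_delE_right hij]
    push_cast
    ring
  have hjmem : j ∈ univ.erase i := by simp [hij.ne']
  have hrest : ∀ l ∈ (univ.erase i).erase j,
      f ((degree' (delE g i j) l : ℝ) - k l) = f 0 := by
    intro l hl
    simp only [Finset.mem_erase, Finset.mem_univ, and_true] at hl
    rw [degree'_delE_of_ne g hl.2 hl.1, hdeg, sub_self]
  rw [qty, ← Finset.add_sum_erase _ _ hjmem, Finset.sum_congr rfl hrest, hi, hj,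
    Finset.sum_erase_eq_sub hjmem, Finset.sum_erase_eq_sub (Finset.mem_univ _), Finset.sum_const,
    Finset.card_univ, Fintype.card_fin, nsmul_eq_mul]
  ring

/-- under condition (⋆), no firm gains by deleting a link. -/
theorem stmt7 (n : ℕ) (hn : 2 ≤ n) (α γ₀ : ℝ) (f : ℝ → ℝ)
    (hconv : ConvexOn ℝ Set.univ f) (hf0 : ∀ x, 0 ≤ f x) (hfmin : ∀ x, f 0 ≤ f x)
    (k : Fin n → ℕ) (hk : ∀ i, k i ≤ n - 1)
    (hstar : 0 < α - γ₀ - n * max (f ((n : ℝ) - 1)) (f (1 - (n : ℝ)))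
      - (((n : ℝ) - 1) / 2) * max (f 1 - f 0) (f (-1) - f 0))
    (g : SimpleGraph (Fin n)) (hdeg : ∀ i, degree' g i = k i)
    (i j : Fin n) (hij : g.Adj i j) :
    profit α γ₀ f k (delE g i j) i ≤ profit α γ₀ f k g i := by
  have hn' : (2 : ℝ) ≤ n := by exact_mod_cast hn
  simp only [profit, price_sub_cost_eq_qty, qty_of_degree'_eq α γ₀ f hdeg,
    qty_delE_of_degree'_eq α γ₀ f hdeg hij]
  have hloss : 0 ≤ ((n : ℝ) - 1) * (f (-1) - f 0) :=
    mul_nonneg (by linarith) (sub_nonneg.2 (hfmin _))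
  have hmax : (n : ℝ) * f 0 ≤ n * max (f ((n : ℝ) - 1)) (f (1 - (n : ℝ))) := by
    gcongr
    exact le_max_of_le_left (hfmin _)
  have hjump : ((n : ℝ) - 1) / 2 * (f (-1) - f 0) ≤
      ((n : ℝ) - 1) / 2 * max (f 1 - f 0) (f (-1) - f 0) :=
    mul_le_mul_of_nonneg_left (le_max_right _ _) (by linarith)
  have hf : f 0 ≤ n * f 0 := le_mul_of_one_le_left (hf0 0) (by linarith)
  apply mul_self_le_mul_self_of_le_of_neg_le
  · exact div_le_div_of_nonneg_right (by linarith) (by positivity)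
  · rw [← neg_div]
    exact div_le_div_of_nonneg_right (by linarith) (by positivity)
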